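/- For n ≥ 3, let (B̃_n, S) be the affine Coxeter system with S = {s_0, s_1,…,s_n}, where m(s_0,s_2) = m(s_1,s_2) = 3, m(s_0,s_1) = 2, m(s_i,s_{i+1}) = 3 for 2 ≤ i ≤ n−2, m(s_{n−1},s_n) = 4, and m = 2 for all other pairs of distinct generators. Then every proper parabolic subgroup of B̃_n is finite, χ̂_{B̃_n}(q) is a polynomial, and χ̂_{B̃_n}(q) = χ̂_{B_n}(q) + Σ_{k=0}^{n} (−1)^k q^{k(k−1)} χ̂_{B_{n−k}}(q), where χ̂_{B_m}(q) is the modified characteristic polynomial of the finite Coxeter group of type B_m and χ̂_{B_i}(q) = 1 for i ≤ 0. -/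

import Mathlib

open Polynomial

namespace CoxeterCharPoly

variable {B W : Type*} [Group W] {M : CoxeterMatrix B}

/-- The left weak order on a Coxeter group. -/
def wle (cs : CoxeterSystem M W) (u w : W) : Prop :=
  cs.length w = cs.length (w * u⁻¹) + cs.length u

/-- The standard parabolic subgroup generated by `J ⊆ S`. -/
def parabolic (cs : CoxeterSystem M W) (J : Set B) : Subgroup W :=
  Subgroup.closure (cs.simple '' J)

/- The longest element of the parabolic subgroup `W_J` (junk value if there is
no element of maximal length). -/
open Classical in
noncomputable def w0 (cs : CoxeterSystem M W) (J : Set B) : W :=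
  if h : ∃ w ∈ parabolic cs J, ∀ u ∈ parabolic cs J, cs.length u ≤ cs.length w
  then h.choose else 1

/-- The right descent set of `w`, as a subset of `B`. -/
def rightDescents (cs : CoxeterSystem M W) (w : W) : Set B :=
  {i | cs.IsRightDescent w i}

/- `μ` is the Möbius function of the subposet `A` of the order `le`. -/
open Classical in
def IsMobiusOn {α : Type*} (le : α → α → Prop) (A : Set α) (μ : α → α → ℤ) : Prop :=
  ∀ a ∈ A, ∀ b ∈ A, le a b →
    (∑ᶠ t ∈ {t | t ∈ A ∧ le a t ∧ le t b}, μ a t) = if a = b then 1 else 0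

/-- The Coxeter matrix of affine type `B̃ₙ`: generators `s₀, s₁, …, s_n` with `m(s₀,s₂) = m(s₁,s₂) = 3`, `m(s₀,s₁) = 2`, `m(s_i,s_{i+1}) = 3` for `2 ≤ i ≤ n-2`, `m(s_{n-1},s_n) = 4`, and `m = 2` for all other pairs -/
def tBmat (n : ℕ) : CoxeterMatrix (Fin (n + 1)) where
  M := Matrix.of fun i j =>
    if i = j then 1
    else if min (i : ℕ) (j : ℕ) + 1 = max (i : ℕ) (j : ℕ) ∧ max (i : ℕ) (j : ℕ) = n then 4
    else if (max (i : ℕ) (j : ℕ) = 2 ∧ min (i : ℕ) (j : ℕ) ≤ 1) ∨ (min (i : ℕ) (j : ℕ) + 1 = max (i : ℕ) (j : ℕ) ∧ 2 ≤ min (i : ℕ) (j : ℕ) ∧ max (i : ℕ) (j : ℕ) + 1 ≤ n) then 3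
    else 2
  isSymm := by
    ext i j
    simp only [Matrix.transpose_apply, Matrix.of_apply]
    by_cases h : i = j
    · subst h; rfl
    · rw [if_neg (Ne.symm h), if_neg h, min_comm, max_comm]
  diagonal := by intro i; simp
  off_diagonal := by
    intro i j h
    simp only [Matrix.of_apply, if_neg h]
    split <;> [simp; skip]
    split <;> simp

/-- The length of the longest element of the standard parabolic subgroup `W_J` of the
Coxeter group of type `Bₙ`. -/
noncomputable def lenB (n : ℕ) (J : Finset (Fin n)) : ℕ :=
  (CoxeterMatrix.Bₙ n).toCoxeterSystem.length
    (w0 (CoxeterMatrix.Bₙ n).toCoxeterSystem (↑J : Set (Fin n)))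

/-- The modified characteristic polynomial `χ̂_{Bₙ}(q) = Σ_{J ⊆ S} (-1)^|J| q^(ℓ(w0(J)))`
of the finite Coxeter group of type `Bₙ` (so `χ̂_{B₀} = 1`). -/
noncomputable def chiB (n : ℕ) : Polynomial ℤ :=
  ∑ J : Finset (Fin n), (-1 : Polynomial ℤ) ^ J.card * X ^ lenB n J

/-- The modified characteristic polynomial of the affine Coxeter group associated to
`tBmat`: `χ̂(q) = Σ_{J ⊆ S, W_J finite} (-1)^|J| q^(ℓ(w0(J)))`. -/
noncomputable def chiAffB (n : ℕ) : Polynomial ℤ :=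
  ∑ᶠ J ∈ {J : Finset (Fin (n + 1)) |
      ((parabolic (tBmat n).toCoxeterSystem (↑J : Set (Fin (n + 1)))) :
        Set (tBmat n).Group).Finite},
    (-1 : Polynomial ℤ) ^ J.card *
      X ^ (tBmat n).toCoxeterSystem.length
        (w0 (tBmat n).toCoxeterSystem (↑J : Set (Fin (n + 1))))

/-- `A` is a (crystallographic) generalized Cartan matrix compatible with the Coxeter matrix `M`. -/
structure IsCartan (M : CoxeterMatrix B) (A : B → B → ℤ) : Prop where
  diag : ∀ i, A i i = 2
  off : ∀ i j, i ≠ j → (M i j = 2 ∧ A i j = 0 ∧ A j i = 0) ∨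
    (M i j = 3 ∧ A i j = -1 ∧ A j i = -1) ∨
    (M i j = 4 ∧ (A i j = -1 ∧ A j i = -2 ∨ A i j = -2 ∧ A j i = -1))

section Representation

set_option linter.unusedSectionVars false

variable [Fintype B] [DecidableEq B] {A : B → B → ℤ}

/-- The linear functional `x ↦ ⟨αᵢ^∨, x⟩` on the root lattice. -/
def coroot (A : B → B → ℤ) (i : B) : (B → ℤ) →ₗ[ℤ] ℤ := ∑ j, A i j • LinearMap.proj j

lemma coroot_apply (i : B) (x : B → ℤ) : coroot A i x = ∑ j, A i j * x j := by
  simp [coroot]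

@[simp] lemma coroot_single (i j : B) : coroot A i (Pi.single j 1) = A i j := by
  simp [coroot_apply, Pi.single_apply]

lemma coroot_eq_zero {K : Set B} {i : B} (hi : ∀ j ∈ K, A i j = 0) {x : B → ℤ}
    (hx : ∀ k ∉ K, x k = 0) : coroot A i x = 0 := by
  rw [coroot_apply]
  refine Finset.sum_eq_zero fun j _ => ?_
  by_cases hj : j ∈ K
  · rw [hi j hj, zero_mul]
  · rw [hx j hj, mul_zero]

/-- The simple reflection on the root lattice. -/
def reflectionEnd (A : B → B → ℤ) (i : B) : Module.End ℤ (B → ℤ) :=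
  LinearMap.id - (coroot A i).smulRight (Pi.single i 1)

lemma reflectionEnd_apply (i : B) (x : B → ℤ) :
    reflectionEnd A i x = x - coroot A i x • Pi.single i 1 := rfl

lemma IsCartan.isLiftable (hA : IsCartan M A) : M.IsLiftable (reflectionEnd A) := by
  intro i j
  refine LinearMap.ext fun x => ?_
  rcases eq_or_ne i j with rfl | hij
  · simp only [M.diagonal, pow_one, Module.End.mul_apply, reflectionEnd_apply, map_sub, map_smul,
      coroot_single, hA.diag, Module.End.one_apply]
    module
  · rcases hA.off i j hij with ⟨hm, ha, hb⟩ | ⟨hm, ha, hb⟩ | ⟨hm, ⟨ha, hb⟩ | ⟨ha, hb⟩⟩ <;>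
    · simp only [hm, pow_succ, pow_zero, one_mul, Module.End.mul_apply, reflectionEnd_apply,
        map_sub, map_smul, coroot_single, hA.diag, ha, hb, Module.End.one_apply]
      module

variable (cs : CoxeterSystem M W) (hA : IsCartan M A)

/-- The action of a Coxeter group on the root lattice. -/
def IsCartan.rep (hA : IsCartan M A) (cs : CoxeterSystem M W) : W →* Module.End ℤ (B → ℤ) :=
  cs.lift ⟨reflectionEnd A, hA.isLiftable⟩

lemma IsCartan.rep_simple (i : B) (x : B → ℤ) :
    hA.rep cs (cs.simple i) x = x - coroot A i x • Pi.single i 1 := by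
  rw [IsCartan.rep, cs.lift_apply_simple hA.isLiftable, reflectionEnd_apply]

lemma IsCartan.rep_mul (u w : W) (x : B → ℤ) :
    hA.rep cs (u * w) x = hA.rep cs u (hA.rep cs w x) := by
  rw [map_mul, Module.End.mul_apply]

lemma IsCartan.rep_injective (w : W) : Function.Injective (hA.rep cs w) := by
  intro x y h
  have := congrArg (hA.rep cs w⁻¹) h
  simpa [← hA.rep_mul] using this

lemma IsCartan.rep_mul_simple_single (w : W) (i j : B) :
    hA.rep cs (w * cs.simple i) (Pi.single j 1) =
      hA.rep cs w (Pi.single j 1) - A i j • hA.rep cs w (Pi.single i 1) := by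
  rw [hA.rep_mul, hA.rep_simple, coroot_single, map_sub, map_smul]

lemma IsCartan.rep_mul_simple_single_self (w : W) (i : B) :
    hA.rep cs (w * cs.simple i) (Pi.single i 1) = - hA.rep cs w (Pi.single i 1) := by
  rw [hA.rep_mul_simple_single, hA.diag]
  module

/-- If `s` is not a right descent of `w`, then `w` maps the simple root of `s` to a
nonnegative combination of simple roots. -/
lemma IsCartan.rep_single_nonneg (w : W) (i : B) (h : ¬ cs.IsRightDescent w i) :
    0 ≤ hA.rep cs w (Pi.single i 1) := by
  induction hk : cs.length w using Nat.strong_induction_on generalizing w i with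
  | _ k ih =>
  subst hk
  rcases eq_or_ne w 1 with rfl | hw
  · rw [map_one, Module.End.one_apply]
    exact Pi.single_nonneg.mpr zero_le_one
  obtain ⟨r, hr⟩ := cs.exists_rightDescent_of_ne_one hw
  have hri : i ≠ r := by rintro rfl; exact h hr
  rw [cs.isRightDescent_iff] at hr
  rw [cs.not_isRightDescent_iff] at h
  have key : ∀ v : W, cs.length v < cs.length w → cs.length (v * cs.simple i) = cs.length v + 1 →
      0 ≤ hA.rep cs v (Pi.single i 1) := fun v hv hd =>
    ih _ hv v i ((cs.not_isRightDescent_iff).2 hd) rfl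
  have key' : ∀ v : W, cs.length v < cs.length w → cs.length (v * cs.simple r) = cs.length v + 1 →
      0 ≤ hA.rep cs v (Pi.single r 1) := fun v hv hd =>
    ih _ hv v r ((cs.not_isRightDescent_iff).2 hd) rfl
  -- strip letters from the right
  set v₁ := w * cs.simple r with hv₁
  have hw₁ : w = v₁ * cs.simple r := by simp [hv₁]
  set v₂ := v₁ * cs.simple i with hv₂
  have hw₂ : v₁ = v₂ * cs.simple i := by simp [hv₂]
  set v₃ := v₂ * cs.simple r with hv₃
  have hw₃ : v₂ = v₃ * cs.simple r := by simp [hv₃]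
  set v₄ := v₃ * cs.simple i with hv₄
  have hw₄ : v₃ = v₄ * cs.simple i := by simp [hv₄]
  have hr₁ : cs.length (v₁ * cs.simple r) = cs.length v₁ + 1 := by rw [← hw₁]; omega
  have d₁ : hA.rep cs w (Pi.single i 1) =
      hA.rep cs v₁ (Pi.single i 1) - A r i • hA.rep cs v₁ (Pi.single r 1) := by
    rw [hw₁, hA.rep_mul_simple_single]
  have d₂ : hA.rep cs v₁ (Pi.single r 1) =
      hA.rep cs v₂ (Pi.single r 1) - A i r • hA.rep cs v₂ (Pi.single i 1) := by
    rw [hw₂, hA.rep_mul_simple_single]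
  have d₂' : hA.rep cs v₁ (Pi.single i 1) = - hA.rep cs v₂ (Pi.single i 1) := by
    rw [hw₂, hA.rep_mul_simple_single_self]
  have d₃ : hA.rep cs v₂ (Pi.single i 1) =
      hA.rep cs v₃ (Pi.single i 1) - A r i • hA.rep cs v₃ (Pi.single r 1) := by
    rw [hw₃, hA.rep_mul_simple_single]
  have d₃' : hA.rep cs v₂ (Pi.single r 1) = - hA.rep cs v₃ (Pi.single r 1) := by
    rw [hw₃, hA.rep_mul_simple_single_self]
  have l₂ : cs.length v₂ = cs.length v₁ + 1 ∨ cs.length v₂ + 1 = cs.length v₁ :=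
    cs.length_mul_simple v₁ i
  have l₃ : cs.length v₃ = cs.length v₂ + 1 ∨ cs.length v₃ + 1 = cs.length v₂ :=
    cs.length_mul_simple v₂ r
  have l₄ : cs.length v₄ = cs.length v₃ + 1 ∨ cs.length v₄ + 1 = cs.length v₃ :=
    cs.length_mul_simple v₃ i
  have e₁ := cs.length_mul_simple (w * cs.simple i) r
  have e₂ := cs.length_mul_simple (w * cs.simple i * cs.simple r) i
  have e₃ := cs.length_mul_simple (w * cs.simple i * cs.simple r * cs.simple i) r
  have braid := cs.wordProd_braidWord_eq i r
  intro b
  rw [d₁]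
  rcases hA.off i r hri with ⟨hm, ha, hb⟩ | ⟨hm, ha, hb⟩ | ⟨hm, hab⟩
  · rw [CoxeterSystem.braidWord, CoxeterSystem.braidWord, M.symmetric r i, hm] at braid
    simp only [CoxeterSystem.alternatingWord, CoxeterSystem.wordProd_concat,
      CoxeterSystem.wordProd_nil, one_mul] at braid
    have e : v₂ = w * cs.simple i * cs.simple r := by
      simp only [hv₂, hv₁, mul_assoc, braid]
    rw [← e] at e₁
    have p := key v₁ (by omega) (by rw [← hv₂]; omega) b
    simp only [hb, Pi.zero_apply, Pi.sub_apply, Pi.smul_apply, smul_eq_mul] at p ⊢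
    omega
  · rw [CoxeterSystem.braidWord, CoxeterSystem.braidWord, M.symmetric r i, hm] at braid
    simp only [CoxeterSystem.alternatingWord, CoxeterSystem.wordProd_concat,
      CoxeterSystem.wordProd_nil, one_mul, mul_assoc] at braid
    have e : v₃ = w * cs.simple i * cs.simple r * cs.simple i := by
      simp only [hv₃, hv₂, hv₁, mul_assoc, braid]
    rw [← e] at e₂
    rcases l₂ with l₂ | l₂
    · have p := key v₁ (by omega) (by rw [← hv₂]; omega) b
      have q := key' v₁ (by omega) (by omega) b
      simp only [hb, Pi.zero_apply, Pi.sub_apply, Pi.smul_apply, smul_eq_mul] at p q ⊢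
      omega
    · have p := key v₂ (by omega) (by rw [← hw₂]; omega) b
      have q := key' v₂ (by omega) (by rw [← hv₃]; omega) b
      rw [d₂', d₂]
      simp only [ha, hb, Pi.zero_apply, Pi.sub_apply, Pi.neg_apply, Pi.smul_apply,
        smul_eq_mul] at p q ⊢
      omega
  · rw [CoxeterSystem.braidWord, CoxeterSystem.braidWord, M.symmetric r i, hm] at braid
    simp only [CoxeterSystem.alternatingWord, CoxeterSystem.wordProd_concat,
      CoxeterSystem.wordProd_nil, one_mul, mul_assoc] at braid
    have e : v₄ = w * cs.simple i * cs.simple r * cs.simple i * cs.simple r := by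
      simp only [hv₄, hv₃, hv₂, hv₁, mul_assoc, braid]
    rw [← e] at e₃
    rcases l₂ with l₂ | l₂
    · have p := key v₁ (by omega) (by rw [← hv₂]; omega) b
      have q := key' v₁ (by omega) (by omega) b
      rcases hab with ⟨ha, hb⟩ | ⟨ha, hb⟩ <;>
      · simp only [hb, Pi.zero_apply, Pi.sub_apply, Pi.smul_apply, smul_eq_mul] at p q ⊢
        omega
    rcases l₃ with l₃ | l₃
    · have p := key v₂ (by omega) (by rw [← hw₂]; omega) b
      have q := key' v₂ (by omega) (by rw [← hv₃]; omega) b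
      rw [d₂', d₂]
      rcases hab with ⟨ha, hb⟩ | ⟨ha, hb⟩ <;>
      · simp only [ha, hb, Pi.zero_apply, Pi.sub_apply, Pi.neg_apply, Pi.smul_apply,
          smul_eq_mul] at p q ⊢
        omega
    · have p := key v₃ (by omega) (by rw [← hv₄]; omega) b
      have q := key' v₃ (by omega) (by rw [← hw₃]; omega) b
      rw [d₂', d₂, d₃', d₃]
      rcases hab with ⟨ha, hb⟩ | ⟨ha, hb⟩ <;>
      · simp only [ha, hb, Pi.zero_apply, Pi.sub_apply, Pi.neg_apply, Pi.smul_apply,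
          smul_eq_mul] at p q ⊢
        omega

lemma IsCartan.rep_single_nonpos (w : W) (i : B) (h : cs.IsRightDescent w i) :
    hA.rep cs w (Pi.single i 1) ≤ 0 := by
  have := hA.rep_single_nonneg cs _ i ((cs.isRightDescent_iff_not_isRightDescent_mul).1 h)
  rwa [hA.rep_mul_simple_single_self, le_neg, neg_zero] at this

lemma IsCartan.rep_single_ne_zero (w : W) (i : B) : hA.rep cs w (Pi.single i 1) ≠ 0 := by
  rw [← map_zero (hA.rep cs w)]
  exact fun h => one_ne_zero (Pi.single_eq_zero_iff.1 (hA.rep_injective cs w h))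

lemma IsCartan.isRightDescent_iff (w : W) (i : B) :
    cs.IsRightDescent w i ↔ hA.rep cs w (Pi.single i 1) ≤ 0 := by
  refine ⟨hA.rep_single_nonpos cs w i, fun h => by_contra fun h' => ?_⟩
  exact hA.rep_single_ne_zero cs w i (le_antisymm h (hA.rep_single_nonneg cs w i h'))

lemma IsCartan.not_isRightDescent_iff (w : W) (i : B) :
    ¬ cs.IsRightDescent w i ↔ 0 ≤ hA.rep cs w (Pi.single i 1) := by
  refine ⟨hA.rep_single_nonneg cs w i, fun h h' => ?_⟩
  exact hA.rep_single_ne_zero cs w i (le_antisymm (hA.rep_single_nonpos cs w i h') h)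

end Representation

section Parabolic

variable (cs : CoxeterSystem M W)

lemma simple_mem_parabolic {J : Set B} {i : B} (hi : i ∈ J) : cs.simple i ∈ parabolic cs J :=
  Subgroup.subset_closure (Set.mem_image_of_mem _ hi)

lemma parabolic_mono {J K : Set B} (h : J ⊆ K) : parabolic cs J ≤ parabolic cs K :=
  Subgroup.closure_mono (Set.image_mono h)

lemma parabolic_univ : parabolic cs Set.univ = ⊤ := by
  rw [parabolic, Set.image_univ, cs.subgroup_closure_range_simple]

lemma parabolic_induction {J : Set B} {p : (w : W) → w ∈ parabolic cs J → Prop}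
    (one : p 1 (one_mem _))
    (mul_simple : ∀ w (hw : w ∈ parabolic cs J) i (hi : i ∈ J), p w hw →
      p (w * cs.simple i) (mul_mem hw (simple_mem_parabolic cs hi)))
    {w : W} (hw : w ∈ parabolic cs J) : p w hw := by
  induction hw using Subgroup.closure_induction_right with
  | one => exact one
  | mul_right x hx y hy h =>
    obtain ⟨i, hi, rfl⟩ := hy
    exact mul_simple x hx i hi h
  | mul_inv_cancel x hx y hy h =>
    obtain ⟨i, hi, rfl⟩ := hy
    simp only [cs.inv_simple]
    exact mul_simple x hx i hi h

/-- `w` is an element of `W_J` for which every `s ∈ J` is a right descent. -/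
def IsLong (J : Set B) (w : W) : Prop :=
  w ∈ parabolic cs J ∧ ∀ i ∈ J, cs.IsRightDescent w i

lemma exists_isLong_of_finite {J : Set B} (h : (parabolic cs J : Set W).Finite) :
    ∃ w, IsLong cs J w := by
  obtain ⟨w, hw, hmax⟩ := h.exists_maximalFor cs.length _ ⟨1, one_mem _⟩
  refine ⟨w, hw, fun i hi => by_contra fun hd => ?_⟩
  rw [cs.not_isRightDescent_iff] at hd
  have := hmax (mul_mem hw (simple_mem_parabolic cs hi)) (by omega)
  omega

variable [Fintype B] [DecidableEq B] {A : B → B → ℤ} (hA : IsCartan M A)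

lemma IsCartan.rep_apply_of_notMem {J : Set B} {w : W} (hw : w ∈ parabolic cs J) (x : B → ℤ)
    {k : B} (hk : k ∉ J) : hA.rep cs w x k = x k := by
  induction hw using parabolic_induction generalizing x with
  | one => simp
  | mul_simple w _ i hi ih =>
    rw [hA.rep_mul, ih, hA.rep_simple]
    have : k ≠ i := by rintro rfl; exact hk hi
    simp [this]

lemma IsCartan.rep_eq_self {J : Set B} {w : W} (hw : w ∈ parabolic cs J) {x : B → ℤ}
    (hx : ∀ i ∈ J, coroot A i x = 0) : hA.rep cs w x = x := by
  induction hw using parabolic_induction with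
  | one => simp
  | mul_simple w _ i hi ih => rw [hA.rep_mul, hA.rep_simple, hx i hi, zero_smul, sub_zero, ih]

lemma IsCartan.rep_eq_sum (w : W) (x : B → ℤ) :
    hA.rep cs w x = ∑ j, x j • hA.rep cs w (Pi.single j 1) := by
  conv_lhs => rw [pi_eq_sum_univ' x]
  simp only [map_sum, map_smul]

lemma IsCartan.rep_nonneg {J : Set B} {v : W} (hv : ∀ j ∈ J, 0 ≤ hA.rep cs v (Pi.single j 1))
    {x : B → ℤ} (hx : 0 ≤ x) (hJ : ∀ k ∉ J, x k = 0) : 0 ≤ hA.rep cs v x := by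
  rw [hA.rep_eq_sum]
  refine Finset.sum_nonneg fun j _ => ?_
  by_cases hj : j ∈ J
  · exact smul_nonneg (hx j) (hv j hj)
  · rw [hJ j hj, zero_smul]

lemma IsCartan.rep_nonpos {J : Set B} {v : W} (hv : ∀ j ∈ J, hA.rep cs v (Pi.single j 1) ≤ 0)
    {x : B → ℤ} (hx : 0 ≤ x) (hJ : ∀ k ∉ J, x k = 0) : hA.rep cs v x ≤ 0 := by
  rw [hA.rep_eq_sum]
  refine Finset.sum_nonpos fun j _ => ?_
  by_cases hj : j ∈ J
  · exact smul_nonpos_of_nonneg_of_nonpos (hx j) (hv j hj)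
  · rw [hJ j hj, zero_smul]

lemma IsCartan.rep_single_apply_of_notMem {J : Set B} {w : W} (hw : w ∈ parabolic cs J)
    {i : B} (hi : i ∈ J) : ∀ k ∉ J, hA.rep cs w (Pi.single i 1) k = 0 := by
  intro k hk
  rw [hA.rep_apply_of_notMem cs hw _ hk]
  have : k ≠ i := by rintro rfl; exact hk hi
  simp [this]

lemma IsLong.length_mul (hA : IsCartan M A) {J : Set B} {w u : W} (hw : IsLong cs J w)
    (hu : u ∈ parabolic cs J) :
    cs.length (w * u) + cs.length u = cs.length w := by
  induction hu using parabolic_induction with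
  | one => simp
  | mul_simple u hu i hi ih =>
    have hw' := fun j hj => hA.rep_single_nonpos cs w j (hw.2 j hj)
    have hsupp := hA.rep_single_apply_of_notMem cs hu hi
    by_cases hd : cs.IsRightDescent u i
    · have h := hA.rep_single_nonpos cs u i hd
      have h' : ¬ cs.IsRightDescent (w * u) i := by
        rw [hA.not_isRightDescent_iff, hA.rep_mul, ← neg_neg (hA.rep cs u _), map_neg,
          le_neg, neg_zero]
        exact hA.rep_nonpos cs hw' (le_neg.1 (by simpa using h)) fun k hk => by
          simp [hsupp k hk]
      rw [cs.isRightDescent_iff] at hd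
      rw [cs.not_isRightDescent_iff, mul_assoc] at h'
      omega
    · have h := hA.rep_single_nonneg cs u i hd
      have h' : cs.IsRightDescent (w * u) i := by
        rw [hA.isRightDescent_iff, hA.rep_mul]
        exact hA.rep_nonpos cs hw' h hsupp
      rw [cs.not_isRightDescent_iff] at hd
      rw [cs.isRightDescent_iff, mul_assoc] at h'
      omega

lemma IsLong.length_le (hA : IsCartan M A) {J : Set B} {w u : W} (hw : IsLong cs J w)
    (hu : u ∈ parabolic cs J) :
    cs.length u ≤ cs.length w := by
  have := hw.length_mul cs hA hu
  omega

lemma IsLong.finite (hA : IsCartan M A) {J : Set B} {w : W} (hw : IsLong cs J w) :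
    (parabolic cs J : Set W).Finite := by
  refine ((List.finite_length_le B (cs.length w)).image cs.wordProd).subset fun u hu => ?_
  obtain ⟨l, hl, rfl⟩ := cs.exists_isReduced u
  exact ⟨l, by simpa [← hl.eq] using hw.length_le cs hA hu, rfl⟩

lemma IsLong.length_w0 (hA : IsCartan M A) {J : Set B} {w : W} (hw : IsLong cs J w) :
    cs.length (w0 cs J) = cs.length w := by
  have h : ∃ w ∈ parabolic cs J, ∀ u ∈ parabolic cs J, cs.length u ≤ cs.length w :=
    ⟨w, hw.1, fun u hu => hw.length_le cs hA hu⟩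
  rw [w0, dif_pos h]
  exact le_antisymm (hw.length_le cs hA h.choose_spec.1) (h.choose_spec.2 w hw.1)

lemma IsCartan.length_mul_of_nonneg {J : Set B} {u v : W}
    (hu : ∀ j ∈ J, 0 ≤ hA.rep cs u (Pi.single j 1)) (hv : v ∈ parabolic cs J) :
    cs.length (u * v) = cs.length u + cs.length v := by
  induction hv using parabolic_induction with
  | one => simp
  | mul_simple v hv i hi ih =>
    have hsupp := hA.rep_single_apply_of_notMem cs hv hi
    by_cases hd : cs.IsRightDescent v i
    · have h := hA.rep_single_nonpos cs v i hd
      have h' : cs.IsRightDescent (u * v) i := by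
        rw [hA.isRightDescent_iff, hA.rep_mul, ← neg_neg (hA.rep cs v _), map_neg,
          neg_le, neg_zero]
        exact hA.rep_nonneg cs hu (le_neg.1 (by simpa using h)) fun k hk => by
          simp [hsupp k hk]
      rw [cs.isRightDescent_iff] at hd
      rw [cs.isRightDescent_iff, mul_assoc] at h'
      omega
    · have h := hA.rep_single_nonneg cs v i hd
      have h' : ¬ cs.IsRightDescent (u * v) i := by
        rw [hA.not_isRightDescent_iff, hA.rep_mul]
        exact hA.rep_nonneg cs hu h hsupp
      rw [cs.not_isRightDescent_iff] at hd
      rw [cs.not_isRightDescent_iff, mul_assoc] at h'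
      omega

/-- Longest elements of mutually orthogonal parabolic subgroups multiply to the longest element,
and lengths add up. -/
lemma IsLong.mul (hA : IsCartan M A) {J K : Set B} {u v : W} (hu : IsLong cs J u) (hv : IsLong cs K v)
    (hJK : ∀ i ∈ J, ∀ j ∈ K, A i j = 0 ∧ A j i = 0) :
    IsLong cs (J ∪ K) (u * v) ∧ cs.length (u * v) = cs.length u + cs.length v := by
  have hfix : ∀ x : B → ℤ, (∀ k ∉ K, x k = 0) → hA.rep cs u x = x := fun x hx =>
    hA.rep_eq_self cs hu.1 fun i hi => coroot_eq_zero (fun j hj => (hJK i hi j hj).1) hx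
  refine ⟨⟨mul_mem (parabolic_mono cs Set.subset_union_left hu.1)
    (parabolic_mono cs Set.subset_union_right hv.1), ?_⟩, ?_⟩
  · rintro i (hi | hi) <;> rw [hA.isRightDescent_iff, hA.rep_mul]
    · rw [hA.rep_eq_self cs hv.1 fun j hj => by rw [coroot_single, (hJK i hi j hj).2],
        ← hA.isRightDescent_iff]
      exact hu.2 i hi
    · rw [hfix _ (hA.rep_single_apply_of_notMem cs hv.1 hi), ← hA.isRightDescent_iff]
      exact hv.2 i hi
  · refine hA.length_mul_of_nonneg cs (J := K) (fun j hj => ?_) hv.1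
    rw [hfix _ fun k hk => ?_]
    · exact Pi.single_nonneg.mpr zero_le_one
    · have : k ≠ j := by rintro rfl; exact hk hj
      simp [this]

/-- A Coxeter group whose root lattice contains a nonzero nonnegative radical vector is
infinite. -/
lemma IsCartan.not_finite_parabolic_univ (hA : IsCartan M A) {x : B → ℤ} (hx : 0 ≤ x) (hx₀ : x ≠ 0)
    (hrad : ∀ i, coroot A i x = 0) : ¬ (parabolic cs (Set.univ : Set B) : Set W).Finite := by
  intro h
  obtain ⟨w, hw⟩ := exists_isLong_of_finite cs h
  have h₁ := hA.rep_nonpos cs (fun j hj => hA.rep_single_nonpos cs w j (hw.2 j hj)) hx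
    (by simp)
  rw [hA.rep_eq_self cs hw.1 fun i _ => hrad i] at h₁
  exact hx₀ (le_antisymm h₁ hx)

end Parabolic

section Embedding

variable {B' W' : Type*} [Group W'] {M' : CoxeterMatrix B'} {A : B → B → ℤ} (cs : CoxeterSystem M W)
  (cs' : CoxeterSystem M' W') (ι : B' → B)

/-- The homomorphism of Coxeter groups induced by a map of generators preserving the Coxeter
matrix. -/
def parabolicHom (hM : ∀ i j, M' i j = M (ι i) (ι j)) : W' →* W :=
  cs'.lift ⟨fun i => cs.simple (ι i), fun i j => by rw [hM, cs.simple_mul_simple_pow]⟩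

variable {ι}

lemma parabolicHom_simple (hM : ∀ i j, M' i j = M (ι i) (ι j)) (i : B') :
    parabolicHom cs cs' ι hM (cs'.simple i) = cs.simple (ι i) := by
  exact cs'.lift_apply_simple _ i

lemma map_parabolic (hM : ∀ i j, M' i j = M (ι i) (ι j)) (J : Set B') :
    (parabolic cs' J).map (parabolicHom cs cs' ι hM) = parabolic cs (ι '' J) := by
  simp only [parabolic, MonoidHom.map_closure, Set.image_image, parabolicHom_simple]

lemma finite_parabolic_image (hM : ∀ i j, M' i j = M (ι i) (ι j)) {J : Set B'}
    (h : (parabolic cs' J : Set W').Finite) : (parabolic cs (ι '' J) : Set W).Finite := by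
  rw [← map_parabolic cs cs' hM, Subgroup.coe_map]
  exact h.image _

lemma IsCartan.comp (hA : IsCartan M A) (hι : Function.Injective ι)
    (hM : ∀ i j, M' i j = M (ι i) (ι j)) : IsCartan M' (fun i j => A (ι i) (ι j)) where
  diag i := hA.diag _
  off i j h := by
    rw [hM]
    exact hA.off _ _ (hι.ne h)

variable [Fintype B] [DecidableEq B] [Fintype B'] [DecidableEq B']

lemma IsCartan.rep_parabolicHom (hA : IsCartan M A) (hι : Function.Injective ι)
    (hM : ∀ i j, M' i j = M (ι i) (ι j)) (w : W') (j k : B') :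
    hA.rep cs (parabolicHom cs cs' ι hM w) (Pi.single (ι j) 1) (ι k) =
      (hA.comp hι hM).rep cs' w (Pi.single j 1) k := by
  induction w using cs'.simple_induction_right generalizing j with
  | one =>
    simp [Pi.single_apply, hι.eq_iff]
  | mul_simple_right w i ih =>
    rw [map_mul, parabolicHom_simple, rep_mul_simple_single, rep_mul_simple_single]
    simp [ih]

lemma IsCartan.length_parabolicHom (hA : IsCartan M A) (hι : Function.Injective ι)
    (hM : ∀ i j, M' i j = M (ι i) (ι j)) (w : W') :
    cs.length (parabolicHom cs cs' ι hM w) = cs'.length w := by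
  have key : ∀ w i, cs'.IsRightDescent w i ↔
      cs.IsRightDescent (parabolicHom cs cs' ι hM w) (ι i) := by
    intro w i
    rw [(hA.comp hι hM).isRightDescent_iff, hA.isRightDescent_iff]
    constructor
    · intro h k
      by_cases hk : k ∈ Set.range ι
      · obtain ⟨k, rfl⟩ := hk
        rw [hA.rep_parabolicHom cs cs' hι hM]
        exact h k
      · have hw : parabolicHom cs cs' ι hM w ∈ parabolic cs (Set.range ι) := by
          rw [← Set.image_univ, ← map_parabolic cs cs' hM, parabolic_univ]
          exact ⟨w, trivial, rfl⟩
        exact (hA.rep_single_apply_of_notMem cs hw (Set.mem_range_self i) k hk).le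
    · intro h k
      rw [← hA.rep_parabolicHom cs cs' hι hM]
      exact h (ι k)
  induction w using cs'.simple_induction_right with
  | one => simp
  | mul_simple_right w i ih =>
    have h := key w i
    rw [map_mul, parabolicHom_simple]
    by_cases hd : cs'.IsRightDescent w i
    · have hd' := h.1 hd
      rw [CoxeterSystem.isRightDescent_iff] at hd hd'
      omega
    · have hd' := mt h.2 hd
      rw [CoxeterSystem.not_isRightDescent_iff] at hd hd'
      omega

lemma IsCartan.parabolicHom_injective (hA : IsCartan M A) (hι : Function.Injective ι)
    (hM : ∀ i j, M' i j = M (ι i) (ι j)) :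
    Function.Injective (parabolicHom cs cs' ι hM) := by
  rw [injective_iff_map_eq_one]
  intro w hw
  rw [← cs'.length_eq_zero_iff, ← hA.length_parabolicHom cs cs' hι hM, hw, cs.length_one]

lemma IsCartan.length_w0_image (hA : IsCartan M A) (hι : Function.Injective ι)
    (hM : ∀ i j, M' i j = M (ι i) (ι j)) {J : Set B'}
    (h : (parabolic cs (ι '' J) : Set W).Finite) :
    cs.length (w0 cs (ι '' J)) = cs'.length (w0 cs' J) := by
  rw [← map_parabolic cs cs' hM, Subgroup.coe_map] at h
  obtain ⟨w, hw⟩ := exists_isLong_of_finite cs'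
    (h.of_finite_image (hA.parabolicHom_injective cs cs' hι hM).injOn)
  have hw' : IsLong cs (ι '' J) (parabolicHom cs cs' ι hM w) := by
    refine ⟨?_, ?_⟩
    · rw [← map_parabolic cs cs' hM]
      exact Subgroup.mem_map_of_mem _ hw.1
    · rintro _ ⟨i, hi, rfl⟩
      have := hw.2 i hi
      rwa [CoxeterSystem.IsRightDescent, ← hA.length_parabolicHom cs cs' hι hM,
        ← hA.length_parabolicHom cs cs' hι hM, map_mul, parabolicHom_simple] at this
  rw [hw.length_w0 cs' (hA.comp hι hM), hw'.length_w0 cs hA,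
    hA.length_parabolicHom cs cs' hι hM]

end Embedding

section AffineB

/-- The `j`-th Euclidean coordinate (`1 ≤ j ≤ n`) of the linear part of the simple root `αₗ` of
`B̃ₙ`, where `α₀ = -e₁ - e₂`, `αₗ = eₗ - eₗ₊₁` for `1 ≤ l < n` and `αₙ = eₙ`. -/
def tBcoef (j l : ℕ) : ℤ :=
  if l = 0 then (if j = 1 ∨ j = 2 then -1 else 0)
  else (if l = j then 1 else 0) - (if l + 1 = j then 1 else 0)

/-- The Cartan matrix of type `B̃ₙ`. -/
def tBcartan (n : ℕ) (i j : Fin (n + 1)) : ℤ :=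
  if (i : ℕ) = 0 then -(tBcoef 1 j + tBcoef 2 j)
  else if (i : ℕ) = n then 2 * tBcoef n j
  else tBcoef i j - tBcoef (i + 1) j

variable {n : ℕ}

lemma tBmat_apply (i j : Fin (n + 1)) :
    tBmat n i j = if i = j then 1
    else if min (i : ℕ) (j : ℕ) + 1 = max (i : ℕ) (j : ℕ) ∧ max (i : ℕ) (j : ℕ) = n then 4
    else if (max (i : ℕ) (j : ℕ) = 2 ∧ min (i : ℕ) (j : ℕ) ≤ 1) ∨
      (min (i : ℕ) (j : ℕ) + 1 = max (i : ℕ) (j : ℕ) ∧ 2 ≤ min (i : ℕ) (j : ℕ) ∧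
        max (i : ℕ) (j : ℕ) + 1 ≤ n) then 3
    else 2 := rfl

lemma tBmat_apply_of_lt {i j : Fin (n + 1)} (h : i < j) :
    tBmat n i j = if (i : ℕ) + 1 = j ∧ (j : ℕ) = n then 4
    else if ((j : ℕ) = 2 ∧ (i : ℕ) ≤ 1) ∨ ((i : ℕ) + 1 = j ∧ 2 ≤ (i : ℕ) ∧ (j : ℕ) + 1 ≤ n) then 3
    else 2 := by
  have h' : (i : ℕ) ≤ j := h.le
  rw [tBmat_apply, if_neg h.ne, min_eq_left h', max_eq_right h']

lemma tBcartan_of_lt {i j : Fin (n + 1)} (h : (i : ℕ) < j) :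
    tBcartan n i j =
      if ((i : ℕ) + 1 = j ∧ (i : ℕ) ≠ 0) ∨ ((i : ℕ) = 0 ∧ (j : ℕ) = 2) then -1 else 0 := by
  have hj := j.isLt
  simp only [tBcartan, tBcoef]
  split_ifs <;> omega

lemma tBcartan_of_gt (hn : 3 ≤ n) {i j : Fin (n + 1)} (h : (i : ℕ) < j) :
    tBcartan n j i = if (i : ℕ) + 1 = j ∧ (j : ℕ) = n then -2
      else if ((i : ℕ) + 1 = j ∧ (i : ℕ) ≠ 0) ∨ ((i : ℕ) = 0 ∧ (j : ℕ) = 2) then -1 else 0 := by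
  have hj := j.isLt
  by_cases hjn : (j : ℕ) = n <;> simp only [tBcartan, tBcoef, hjn, if_true, if_false] <;>
    split_ifs <;> first | omega | simp_all

lemma tBcartan_off (hn : 3 ≤ n) {i j : Fin (n + 1)} (h : i < j) :
    (tBmat n i j = 2 ∧ tBcartan n i j = 0 ∧ tBcartan n j i = 0) ∨
    (tBmat n i j = 3 ∧ tBcartan n i j = -1 ∧ tBcartan n j i = -1) ∨
    (tBmat n i j = 4 ∧ tBcartan n i j = -1 ∧ tBcartan n j i = -2) := by
  have h' : (i : ℕ) < j := h
  have hj := j.isLt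
  rw [tBmat_apply_of_lt h, tBcartan_of_lt h', tBcartan_of_gt hn h']
  split_ifs <;> omega

lemma isCartan_tBcartan (hn : 3 ≤ n) : IsCartan (tBmat n) (tBcartan n) where
  diag i := by
    have := i.isLt
    simp only [tBcartan, tBcoef]
    split_ifs <;> first | omega | simp_all
  off i j hij := by
    rcases lt_or_gt_of_ne hij with h | h
    · have := tBcartan_off hn h
      tauto
    · have := tBcartan_off hn h
      rw [(tBmat n).symmetric]
      tauto

/-- The `j`-th Euclidean coordinate of the linear part of an element of the root lattice. -/
def tBcoord (n j : ℕ) : (Fin (n + 1) → ℤ) →ₗ[ℤ] ℤ :=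
  ∑ l : Fin (n + 1), tBcoef j l • LinearMap.proj l

lemma tBcoord_apply (j : ℕ) (x : Fin (n + 1) → ℤ) :
    tBcoord n j x = ∑ l : Fin (n + 1), tBcoef j l * x l := by
  simp [tBcoord]

@[simp] lemma tBcoord_single (j : ℕ) (i : Fin (n + 1)) :
    tBcoord n j (Pi.single i 1) = tBcoef j i := by
  simp [tBcoord_apply, Pi.single_apply]

lemma coroot_tBcartan (i : Fin (n + 1)) (x : Fin (n + 1) → ℤ) :
    coroot (tBcartan n) i x =
      if (i : ℕ) = 0 then -(tBcoord n 1 x + tBcoord n 2 x)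
      else if (i : ℕ) = n then 2 * tBcoord n n x
      else tBcoord n i x - tBcoord n (i + 1) x := by
  simp only [coroot_apply, tBcartan, tBcoord_apply]
  split_ifs
  · simp only [← Finset.sum_add_distrib, ← Finset.sum_neg_distrib]
    exact Finset.sum_congr rfl fun _ _ => by ring
  · rw [Finset.mul_sum]
    exact Finset.sum_congr rfl fun _ _ => by ring
  · rw [← Finset.sum_sub_distrib]
    exact Finset.sum_congr rfl fun _ _ => by ring

lemma tBcoord_one (hn : 3 ≤ n) (x : Fin (n + 1) → ℤ) :
    tBcoord n 1 x = x ⟨1, by omega⟩ - x ⟨0, by omega⟩ := by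
  have h : ∀ l : Fin (n + 1), tBcoef 1 l * x l =
      (if l = ⟨1, by omega⟩ then x l else 0) - (if l = ⟨0, by omega⟩ then x l else 0) := by
    intro l
    simp only [tBcoef, Fin.ext_iff]
    split_ifs <;> first | omega | ring1 | simp_all
  simp only [tBcoord_apply, h, Finset.sum_sub_distrib, Finset.sum_ite_eq', Finset.mem_univ, if_true]

lemma tBcoord_two (hn : 3 ≤ n) (x : Fin (n + 1) → ℤ) :
    tBcoord n 2 x = x ⟨2, by omega⟩ - x ⟨1, by omega⟩ - x ⟨0, by omega⟩ := by
  have h : ∀ l : Fin (n + 1), tBcoef 2 l * x l =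
      (if l = ⟨2, by omega⟩ then x l else 0) - (if l = ⟨1, by omega⟩ then x l else 0) -
        (if l = ⟨0, by omega⟩ then x l else 0) := by
    intro l
    simp only [tBcoef, Fin.ext_iff]
    split_ifs <;> first | omega | ring1 | simp_all
  simp only [tBcoord_apply, h, Finset.sum_sub_distrib, Finset.sum_ite_eq', Finset.mem_univ, if_true]

lemma tBcoord_succ {i : ℕ} (hi : 2 ≤ i) (hin : i + 1 < n + 1) (x : Fin (n + 1) → ℤ) :
    tBcoord n (i + 1) x = x ⟨i + 1, hin⟩ - x ⟨i, by omega⟩ := by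
  have h : ∀ l : Fin (n + 1), tBcoef (i + 1) l * x l =
      (if l = ⟨i + 1, hin⟩ then x l else 0) - (if l = ⟨i, by omega⟩ then x l else 0) := by
    intro l
    simp only [tBcoef, Fin.ext_iff]
    split_ifs <;> omega
  simp only [tBcoord_apply, h, Finset.sum_sub_distrib, Finset.sum_ite_eq', Finset.mem_univ, if_true]

variable {cs : CoxeterSystem (tBmat n) W} (hA : IsCartan (tBmat n) (tBcartan n))

lemma tBcoord_rep_simple (i : Fin (n + 1)) (j : ℕ) (x : Fin (n + 1) → ℤ) :
    tBcoord n j (hA.rep cs (cs.simple i) x) =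
      tBcoord n j x - coroot (tBcartan n) i x * tBcoef j i := by
  rw [hA.rep_simple, map_sub, map_smul, tBcoord_single, smul_eq_mul]

lemma tBcoord_rep_simple_zero (j : ℕ) (x : Fin (n + 1) → ℤ) :
    tBcoord n j (hA.rep cs (cs.simple 0) x) =
      if j = 1 then -tBcoord n 2 x else if j = 2 then -tBcoord n 1 x else tBcoord n j x := by
  rw [tBcoord_rep_simple, coroot_tBcartan]
  simp only [Fin.val_zero, if_true, tBcoef]
  split_ifs <;> subst_vars <;> omega

lemma tBcoord_rep_simple_last (hn : 3 ≤ n) (j : ℕ) (hj : j ≤ n) (x : Fin (n + 1) → ℤ) :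
    tBcoord n j (hA.rep cs (cs.simple (Fin.last n)) x) =
      if j = n then -tBcoord n j x else tBcoord n j x := by
  rw [tBcoord_rep_simple, coroot_tBcartan]
  simp only [Fin.val_last, tBcoef]
  split_ifs <;> subst_vars <;> omega

lemma tBcoord_rep_simple_mid {i : ℕ} (hi : 1 ≤ i) (hin : i < n) (j : ℕ)
    (x : Fin (n + 1) → ℤ) :
    tBcoord n j (hA.rep cs (cs.simple ⟨i, by omega⟩) x) =
      if j = i then tBcoord n (i + 1) x else if j = i + 1 then tBcoord n i x
      else tBcoord n j x := by
  rw [tBcoord_rep_simple, coroot_tBcartan]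
  simp only [tBcoef]
  split_ifs <;> subst_vars <;> omega

lemma exists_neg_tBcoord (hn : 3 ≤ n) (d : ℕ) : ∀ i : ℕ, i + d = n → 1 ≤ i →
    ∃ g ∈ parabolic cs {l : Fin (n + 1) | i ≤ (l : ℕ)}, ∀ j, j ≤ n → ∀ x,
      tBcoord n j (hA.rep cs g x) = if j = i then -tBcoord n j x else tBcoord n j x := by
  induction d with
  | zero =>
    rintro i rfl -
    refine ⟨cs.simple (Fin.last _), simple_mem_parabolic cs (by simp), fun j hj x => ?_⟩
    exact tBcoord_rep_simple_last hA hn j hj x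
  | succ d ih =>
    intro i hi hi₁
    obtain ⟨g, hg, h⟩ := ih (i + 1) (by omega) (by omega)
    have hs : cs.simple ⟨i, by omega⟩ ∈ parabolic cs {l : Fin (n + 1) | i ≤ (l : ℕ)} :=
      simple_mem_parabolic cs (by simp)
    refine ⟨cs.simple ⟨i, by omega⟩ * g * cs.simple ⟨i, by omega⟩, mul_mem (mul_mem hs
      (parabolic_mono cs (fun l (hl : i + 1 ≤ (l : ℕ)) => by simp; omega) hg)) hs,
      fun j hj x => ?_⟩
    simp only [hA.rep_mul, tBcoord_rep_simple_mid hA hi₁ (show i < n by omega)]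
    rw [h _ (by omega), h _ (by omega), h _ hj]
    simp only [tBcoord_rep_simple_mid hA hi₁ (show i < n by omega)]
    split_ifs <;> subst_vars <;> omega

lemma exists_neg_tBcoord_le (hn : 3 ≤ n) (d : ℕ) (hd : d ≤ n) :
    ∃ g ∈ parabolic cs {l : Fin (n + 1) | 1 ≤ (l : ℕ)}, ∀ j, 1 ≤ j → j ≤ n → ∀ x,
      tBcoord n j (hA.rep cs g x) = if j ≤ d then -tBcoord n j x else tBcoord n j x := by
  induction d with
  | zero => exact ⟨1, one_mem _, fun j hj _ x => by rw [if_neg (by omega)]; simp⟩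
  | succ d ih =>
    obtain ⟨g, hg, h⟩ := ih (by omega)
    obtain ⟨g', hg', h'⟩ := exists_neg_tBcoord (cs := cs) hA hn (n - (d + 1)) (d + 1) (by omega) (by omega)
    refine ⟨g' * g, mul_mem (parabolic_mono cs
      (fun l (hl : d + 1 ≤ (l : ℕ)) => by simp; omega) hg') hg, fun j hj hjn x => ?_⟩
    rw [hA.rep_mul, h' j hjn, h j hj hjn]
    split_ifs <;> omega

lemma eq_zero_of_tBcoord_eq_zero (hn : 3 ≤ n) {y : Fin (n + 1) → ℤ} (hy₀ : y 0 = 0)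
    (hy : ∀ j, 1 ≤ j → j ≤ n → tBcoord n j y = 0) : y = 0 := by
  have h₀ : y ⟨0, by omega⟩ = 0 := hy₀
  have h₁ : y ⟨1, by omega⟩ = 0 := by
    have := hy 1 le_rfl (by omega)
    rw [tBcoord_one hn] at this
    omega
  have h₂ : ∀ i, 2 ≤ i → ∀ hi : i < n + 1, y ⟨i, hi⟩ = 0 := by
    intro i hi
    induction i, hi using Nat.le_induction with
    | base =>
      intro _
      have := hy 2 (by omega) (by omega)
      rw [tBcoord_two hn] at this
      omega
    | succ i hi ih =>
      intro hin
      have := hy (i + 1) (by omega) (by omega)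
      rw [tBcoord_succ hi hin, ih (by omega)] at this
      omega
  ext ⟨i, hi⟩
  rcases i with _ | _ | i
  · exact h₀
  · exact h₁
  · exact h₂ _ (by omega) hi

variable (cs) in
lemma finite_parabolic_pos (hn : 3 ≤ n) :
    (parabolic cs {l : Fin (n + 1) | 1 ≤ (l : ℕ)} : Set W).Finite := by
  have hA := isCartan_tBcartan hn
  obtain ⟨w, hw, h⟩ := exists_neg_tBcoord_le (cs := cs) hA hn n le_rfl
  refine IsLong.finite cs hA ⟨hw, fun i hi => ?_⟩
  have hi : 1 ≤ (i : ℕ) := hi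
  have hi0 : i ≠ 0 := by rintro rfl; simp at hi
  have : hA.rep cs w (Pi.single i 1) + Pi.single i 1 = 0 := by
    refine eq_zero_of_tBcoord_eq_zero hn ?_ fun j hj hjn => ?_
    · rw [Pi.add_apply, hA.rep_apply_of_notMem cs hw _ (by simp)]
      simp [hi0.symm]
    · rw [map_add, h j hj hjn, if_pos hjn, neg_add_cancel]
  rw [hA.isRightDescent_iff, eq_neg_of_add_eq_zero_left this, neg_nonpos]
  exact Pi.single_nonneg.2 zero_le_one

lemma length_mul_simple_of_tBcoord_neg {k : ℕ} {v p : W}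
    (hv : v ∈ parabolic cs {l : Fin (n + 1) | (l : ℕ) ≤ k})
    (hvx : ∀ x, tBcoord n (k + 1) (hA.rep cs v x) = tBcoord n (k + 1) x)
    (hp : p ∈ parabolic cs {l : Fin (n + 1) | (l : ℕ) ≤ k}) {s : Fin (n + 1)} (hs : (s : ℕ) ≤ k)
    (hneg : tBcoord n (k + 1) (hA.rep cs p (Pi.single s 1)) < 0) :
    cs.length (v * (p * cs.simple s)) = cs.length (v * p) + 1 := by
  rw [← mul_assoc]
  refine cs.not_isRightDescent_iff.1 fun h => hneg.not_ge ?_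
  have hy := hA.rep_single_nonpos cs _ _ h
  rw [← hvx, ← hA.rep_mul, tBcoord_apply]
  refine Finset.sum_nonneg fun l _ => ?_
  by_cases hl : (l : ℕ) = k + 1
  · rw [hA.rep_apply_of_notMem cs (mul_mem hv hp) _ (by simp; omega), Pi.single_eq_of_ne, mul_zero]
    rintro rfl
    omega
  · refine mul_nonneg_of_nonpos_of_nonpos ?_ (hy l)
    simp only [tBcoef]
    split_ifs <;> omega

lemma exists_descending_word {k : ℕ} (hkn : k < n) {v : W}
    (hv : v ∈ parabolic cs {l : Fin (n + 1) | (l : ℕ) ≤ k})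
    (hvx : ∀ x, tBcoord n (k + 1) (hA.rep cs v x) = tBcoord n (k + 1) x)
    (d i : ℕ) (hd : i + d = k) :
    ∃ p ∈ parabolic cs {l : Fin (n + 1) | (l : ℕ) ≤ k}, cs.length (v * p) = cs.length v + d ∧
      ∀ j x, tBcoord n j (hA.rep cs p x) =
        if j = k + 1 then tBcoord n (i + 1) x
        else if i + 1 ≤ j ∧ j ≤ k then tBcoord n (j + 1) x
        else tBcoord n j x := by
  induction d generalizing i with
  | zero =>
    refine ⟨1, one_mem _, by simp, fun j x => ?_⟩
    rw [map_one, Module.End.one_apply]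
    split_ifs <;> first | rfl | omega | (congr; omega)
  | succ d ih =>
    obtain ⟨p, hp, hl, h⟩ := ih (i + 1) (by omega)
    refine ⟨p * cs.simple ⟨i + 1, by omega⟩, mul_mem hp (simple_mem_parabolic cs (by simp; omega)),
      ?_, fun j x => ?_⟩
    · rw [length_mul_simple_of_tBcoord_neg hA hv hvx hp (by simp; omega), hl, add_assoc]
      simp [h, tBcoef]
    · rw [hA.rep_mul, h]
      simp only [tBcoord_rep_simple_mid hA (show 1 ≤ i + 1 by omega) (show i + 1 < n by omega)]
      split_ifs <;> first | rfl | omega | (congr; omega)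

lemma exists_turning_word {k : ℕ} (hk : 1 ≤ k) (hkn : k < n) {v : W}
    (hv : v ∈ parabolic cs {l : Fin (n + 1) | (l : ℕ) ≤ k})
    (hvx : ∀ x, tBcoord n (k + 1) (hA.rep cs v x) = tBcoord n (k + 1) x) :
    ∃ p ∈ parabolic cs {l : Fin (n + 1) | (l : ℕ) ≤ k}, cs.length (v * p) = cs.length v + (k + 1) ∧
      ∀ j x, 2 ≤ j → tBcoord n j (hA.rep cs p x) =
        if j = k + 1 then -tBcoord n 2 x
        else if j ≤ k then tBcoord n (j + 1) x
        else tBcoord n j x := by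
  obtain ⟨p, hp, hl, h⟩ := exists_descending_word hA hkn hv hvx k 0 (by omega)
  refine ⟨p * cs.simple 0, mul_mem hp (simple_mem_parabolic cs (by simp)), ?_, fun j x hj => ?_⟩
  · rw [length_mul_simple_of_tBcoord_neg hA hv hvx hp (by simp), hl, add_assoc]
    simp [h, tBcoef]
  · rw [hA.rep_mul, h]
    simp only [tBcoord_rep_simple_zero hA]
    split_ifs <;> first | rfl | omega

lemma exists_ascending_word {k : ℕ} (hkn : k < n) {v : W}
    (hv : v ∈ parabolic cs {l : Fin (n + 1) | (l : ℕ) ≤ k})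
    (hvx : ∀ x, tBcoord n (k + 1) (hA.rep cs v x) = tBcoord n (k + 1) x)
    (i : ℕ) (hi : i + 1 ≤ k) :
    ∃ p ∈ parabolic cs {l : Fin (n + 1) | (l : ℕ) ≤ k},
      cs.length (v * p) = cs.length v + (k + 1 + i) ∧
      ∀ j x, 2 ≤ j → tBcoord n j (hA.rep cs p x) =
        if j = k + 1 then -tBcoord n (i + 2) x
        else if i + 1 < j ∧ j ≤ k then tBcoord n (j + 1) x
        else tBcoord n j x := by
  induction i with
  | zero =>
    obtain ⟨p, hp, hl, h⟩ := exists_turning_word hA (by omega) hkn hv hvx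
    refine ⟨p, hp, hl, fun j x hj => ?_⟩
    rw [h j x hj]
    split_ifs <;> first | rfl | omega
  | succ i ih =>
    obtain ⟨p, hp, hl, h⟩ := ih (by omega)
    refine ⟨p * cs.simple ⟨i + 2, by omega⟩, mul_mem hp (simple_mem_parabolic cs (by simp; omega)),
      ?_, fun j x hj => ?_⟩
    · rw [length_mul_simple_of_tBcoord_neg hA hv hvx hp (by simp; omega), hl]
      · omega
      · simp [h _ _ (show 2 ≤ k + 1 by omega), tBcoef]
    · rw [hA.rep_mul, h _ _ hj]
      simp only [tBcoord_rep_simple_mid hA (show 1 ≤ i + 2 by omega) (show i + 2 < n by omega)]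
      split_ifs <;> first | rfl | omega | (congr; omega)

lemma exists_neg_tBcoord_lt {k : ℕ} (hk : 1 ≤ k) (hkn : k ≤ n) :
    ∃ w ∈ parabolic cs {l : Fin (n + 1) | (l : ℕ) < k}, cs.length w = k * (k - 1) ∧
      ∀ j x, 2 ≤ j → tBcoord n j (hA.rep cs w x) =
        if j ≤ k then -tBcoord n j x else tBcoord n j x := by
  induction k, hk using Nat.le_induction with
  | base => exact ⟨1, one_mem _, by simp, fun j x hj => by rw [if_neg (by omega)]; simp⟩
  | succ k hk ih =>
    obtain ⟨v, hv, hl, h⟩ := ih (by omega)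
    have hv' : v ∈ parabolic cs {l : Fin (n + 1) | (l : ℕ) ≤ k} :=
      parabolic_mono cs (fun l (hl : (l : ℕ) < k) => hl.le) hv
    obtain ⟨p, hp, hl', h'⟩ := exists_ascending_word hA hkn hv'
      (fun x => by rw [h _ _ (by omega), if_neg (by omega)]) (k - 1) (by omega)
    simp only [Nat.lt_succ_iff]
    refine ⟨v * p, mul_mem hv' hp, ?_, fun j x hj => ?_⟩
    · obtain ⟨m, rfl⟩ := Nat.exists_eq_add_of_le' hk
      rw [hl', hl]
      simp only [Nat.add_sub_cancel]
      ring
    · rw [hA.rep_mul, h j _ hj, h' j _ hj]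
      split_ifs <;> first | rfl | omega | (congr; omega)

lemma eq_zero_of_tBcoord_eq_zero_of_nonneg (hn : 3 ≤ n) {k : ℕ} (hk : 2 ≤ k) (hkn : k ≤ n)
    {y : Fin (n + 1) → ℤ} (hy₀ : 0 ≤ y) (hyk : ∀ l : Fin (n + 1), k ≤ (l : ℕ) → y l = 0)
    (hy : ∀ j, 2 ≤ j → j ≤ k → tBcoord n j y = 0) : y = 0 := by
  have h₂ : ∀ d i, i + d = k → 2 ≤ i → ∀ hi : i < n + 1, y ⟨i, hi⟩ = 0 := by
    intro d
    induction d with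
    | zero => exact fun i hd _ hi => hyk _ (by simp; omega)
    | succ d ih =>
      intro i hd hi₂ hi
      have h := ih (i + 1) (by omega) (by omega) (by omega)
      have := hy (i + 1) (by omega) (by omega)
      rw [tBcoord_succ hi₂ (by omega), h] at this
      omega
  have h01 := hy 2 le_rfl hk
  rw [tBcoord_two hn, h₂ (k - 2) 2 (by omega) le_rfl] at h01
  have h0 : 0 ≤ y ⟨0, by omega⟩ := hy₀ _
  have h1 : 0 ≤ y ⟨1, by omega⟩ := hy₀ _
  ext ⟨i, hi⟩
  rcases i with _ | _ | i
  · change y ⟨0, _⟩ = 0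
    omega
  · change y ⟨1, _⟩ = 0
    omega
  · rcases le_total k (i + 2) with h | h
    · exact hyk _ h
    · exact h₂ (k - (i + 2)) _ (by omega) (by omega) hi

variable (cs) in
lemma exists_isLong_lt (hn : 3 ≤ n) {k : ℕ} (hk : 2 ≤ k) (hkn : k ≤ n) :
    ∃ w, IsLong cs {l : Fin (n + 1) | (l : ℕ) < k} w ∧ cs.length w = k * (k - 1) := by
  have hA := isCartan_tBcartan hn
  obtain ⟨w, hw, hl, h⟩ := exists_neg_tBcoord_lt (cs := cs) hA (show 1 ≤ k by omega) hkn
  refine ⟨w, ⟨hw, fun i hi => ?_⟩, hl⟩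
  have hi : (i : ℕ) < k := hi
  by_contra hd
  have hnn := hA.rep_single_nonneg cs w i hd
  have : hA.rep cs w (Pi.single i 1) + Pi.single i 1 = 0 := by
    refine eq_zero_of_tBcoord_eq_zero_of_nonneg hn hk hkn
      (add_nonneg hnn (Pi.single_nonneg.2 zero_le_one)) (fun l hl => ?_) fun j hj hjk => ?_
    · rw [Pi.add_apply, hA.rep_apply_of_notMem cs hw _ (by simpa using hl), Pi.single_eq_of_ne,
        add_zero]
      rintro rfl
      omega
    · rw [map_add, h j _ hj, if_pos hjk, neg_add_cancel]
  have h1 := congrFun this i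
  have h2 := hnn i
  simp only [Pi.add_apply, Pi.single_eq_same, Pi.zero_apply] at h1 h2
  omega

lemma tBcartan_eq_zero {i j : Fin (n + 1)} {k : ℕ} (hn : 3 ≤ n) (hk : 2 ≤ k) (hi : (i : ℕ) < k)
    (hj : k < (j : ℕ)) : tBcartan n i j = 0 ∧ tBcartan n j i = 0 := by
  rw [tBcartan_of_lt (by omega), tBcartan_of_gt hn (by omega)]
  constructor <;> split_ifs <;> omega

lemma tBmat_of_le_one {i j : Fin (n + 1)} (hn : 3 ≤ n) (hij : i ≠ j) (hi : (i : ℕ) ≤ 1) :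
    tBmat n i j = if (j : ℕ) = 2 then 3 else 2 := by
  have : (i : ℕ) ≠ j := fun h => hij (Fin.ext h)
  rcases lt_or_gt_of_ne hij with h | h
  · rw [tBmat_apply_of_lt h]
    split_ifs <;> omega
  · have : (j : ℕ) < i := h
    rw [(tBmat n).symmetric, tBmat_apply_of_lt h]
    split_ifs <;> omega

lemma swap_eq_or (hn : 3 ≤ n) (i : Fin (n + 1)) :
    ((i : ℕ) ≤ 1 ∧ ((Equiv.swap 0 1 i : Fin (n + 1)) : ℕ) ≤ 1) ∨
      (2 ≤ (i : ℕ) ∧ Equiv.swap 0 1 i = i) := by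
  have h1 : ((1 : Fin (n + 1)) : ℕ) = 1 := by
    rw [Fin.val_one', Nat.mod_eq_of_lt (by omega)]
  by_cases h : 2 ≤ (i : ℕ)
  · refine Or.inr ⟨h, Equiv.swap_apply_of_ne_of_ne (fun hi => ?_) fun hi => ?_⟩
    · rw [hi, Fin.val_zero] at h
      omega
    · rw [hi, h1] at h
      omega
  · refine Or.inl ⟨by omega, ?_⟩
    obtain rfl | rfl : i = 0 ∨ i = 1 := by
      rw [Fin.ext_iff, Fin.ext_iff, h1, Fin.val_zero]
      omega
    · rw [Equiv.swap_apply_left, h1]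
    · rw [Equiv.swap_apply_right, Fin.val_zero]
      omega

lemma tBmat_swap (hn : 3 ≤ n) (i j : Fin (n + 1)) :
    tBmat n i j = tBmat n (Equiv.swap 0 1 i) (Equiv.swap 0 1 j) := by
  by_cases hij : i = j
  · subst hij
    rw [(tBmat n).diagonal, (tBmat n).diagonal]
  have hσ := (Equiv.swap (0 : Fin (n + 1)) 1).injective.ne hij
  rcases swap_eq_or hn i with ⟨hi, hi'⟩ | ⟨hi, hi'⟩ <;>
    rcases swap_eq_or hn j with ⟨hj, hj'⟩ | ⟨hj, hj'⟩
  · rw [tBmat_of_le_one hn hij hi, tBmat_of_le_one hn hσ hi', if_neg (by omega), if_neg (by omega)]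
  · rw [tBmat_of_le_one hn hij hi, tBmat_of_le_one hn hσ hi', hj']
  · rw [(tBmat n).symmetric, (tBmat n).symmetric (Equiv.swap 0 1 i),
      tBmat_of_le_one hn (Ne.symm hij) hj, tBmat_of_le_one hn (Ne.symm hσ) hj', hi']
  · rw [hi', hj']

variable (cs) in
lemma finite_parabolic_swap (hn : 3 ≤ n) {J : Set (Fin (n + 1))}
    (h : (parabolic cs J : Set W).Finite) :
    (parabolic cs (Equiv.swap 0 1 '' J) : Set W).Finite :=
  finite_parabolic_image cs cs (tBmat_swap hn) h

variable (cs) in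
lemma exists_isLong_gt (hn : 3 ≤ n) (k : ℕ) :
    ∃ w, IsLong cs {l : Fin (n + 1) | k < (l : ℕ)} w :=
  exists_isLong_of_finite cs <| (finite_parabolic_pos cs hn).subset <|
    parabolic_mono cs fun l (hl : k < (l : ℕ)) => Nat.one_le_of_lt hl

variable (cs) in
lemma finite_parabolic_of_ne_univ (hn : 3 ≤ n) {J : Set (Fin (n + 1))} (hJ : J ≠ Set.univ) :
    (parabolic cs J : Set W).Finite := by
  have hA := isCartan_tBcartan hn
  have h₀ : ∀ J : Set (Fin (n + 1)), (0 : Fin (n + 1)) ∉ J → (parabolic cs J : Set W).Finite :=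
    fun J h => (finite_parabolic_pos cs hn).subset <| parabolic_mono cs fun l hl => by
      have : l ≠ 0 := by rintro rfl; exact h hl
      exact Nat.one_le_iff_ne_zero.2 fun h => this (Fin.ext h)
  obtain ⟨k, hk⟩ := (Set.ne_univ_iff_exists_notMem J).1 hJ
  rcases k with ⟨_ | _ | k, hkn⟩
  · exact h₀ J hk
  · have := finite_parabolic_swap cs hn (h₀ (Equiv.swap 0 1 '' J) ?_)
    · rwa [← Set.image_comp, ← Equiv.coe_trans, Equiv.swap_swap, Equiv.coe_refl,
        Set.image_id] at this
    · rw [Equiv.image_eq_preimage_symm, Set.mem_preimage, Equiv.symm_swap, Equiv.swap_apply_left]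
      convert hk
      obtain ⟨m, rfl⟩ := Nat.exists_eq_add_of_le' (show 1 ≤ n by omega)
      rfl
  · obtain ⟨u, hu, -⟩ := exists_isLong_lt cs hn (show 2 ≤ k + 2 by omega) (by omega)
    obtain ⟨v, hv⟩ := exists_isLong_gt cs hn (k + 2)
    refine ((hu.mul cs hA hv fun i hi j hj => tBcartan_eq_zero hn (show 2 ≤ k + 2 by omega)
      hi hj).1.finite cs hA).subset <| parabolic_mono cs fun l hl => ?_
    have : (l : ℕ) ≠ k + 2 := by
      intro h
      exact hk (by convert hl; exact h.symm)
    rcases lt_or_gt_of_ne this with h | h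
    · exact Or.inl h
    · exact Or.inr h

variable (cs) in
lemma not_finite_parabolic_tBmat (hn : 3 ≤ n) :
    ¬ (parabolic cs (Set.univ : Set (Fin (n + 1))) : Set W).Finite := by
  have hA := isCartan_tBcartan hn
  let δ : Fin (n + 1) → ℤ := fun l => if (l : ℕ) ≤ 1 then 1 else 2
  have hδ : ∀ j, 1 ≤ j → j ≤ n → tBcoord n j δ = 0 := by
    intro j hj hjn
    obtain rfl | rfl | h : j = 1 ∨ j = 2 ∨ 3 ≤ j := by omega
    · simp [tBcoord_one hn, δ]
    · simp [tBcoord_two hn, δ]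
    · obtain ⟨i, rfl⟩ := Nat.exists_eq_add_of_le' (show 1 ≤ j by omega)
      rw [tBcoord_succ (by omega) (by omega)]
      simp only [δ]
      split_ifs <;> omega
  refine hA.not_finite_parabolic_univ cs (x := δ) (fun l => ?_) (fun h => ?_) fun i => ?_
  · simp only [δ, Pi.zero_apply]
    split_ifs <;> omega
  · simpa [δ] using congrFun h 0
  · have := i.isLt
    rw [coroot_tBcartan]
    split_ifs
    · rw [hδ 1 (by omega) (by omega), hδ 2 (by omega) (by omega)]
      rfl
    · rw [hδ n (by omega) le_rfl, mul_zero]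
    · rw [hδ i (by omega) (by omega), hδ (i + 1) (by omega) (by omega), sub_zero]

section Sum

/-- The inclusion of the last `n - k` nodes of the diagram of `B̃ₙ`. -/
def tBshift (n k : ℕ) : Fin (n - k) ↪ Fin (n + 1) where
  toFun i := ⟨k + 1 + i, by omega⟩
  inj' i j h := by
    have := congrArg Fin.val h
    simp only at this
    exact Fin.ext (by omega)

@[simp] lemma val_tBshift (k : ℕ) (i : Fin (n - k)) : (tBshift n k i : ℕ) = k + 1 + i := rfl

lemma Bₙ_apply (m : ℕ) (i j : Fin m) : CoxeterMatrix.Bₙ m i j =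
    if i = j then 1 else if ((i : ℕ) = m - 1 ∧ (j : ℕ) = m - 2) ∨
      ((j : ℕ) = m - 1 ∧ (i : ℕ) = m - 2) then 4
    else if (j : ℕ) + 1 = i ∨ (i : ℕ) + 1 = j then 3 else 2 := rfl

lemma Bₙ_eq_tBmat (hn : 3 ≤ n) (k : ℕ) (i j : Fin (n - k)) :
    CoxeterMatrix.Bₙ (n - k) i j = tBmat n (tBshift n k i) (tBshift n k j) := by
  have key : ∀ i j : Fin (n - k), i < j →
      CoxeterMatrix.Bₙ (n - k) i j = tBmat n (tBshift n k i) (tBshift n k j) := by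
    intro i j hij
    have hij' : (i : ℕ) < j := hij
    have hj := j.isLt
    trans if (i : ℕ) + 1 = j ∧ (j : ℕ) + 1 = n - k then 4 else if (i : ℕ) + 1 = j then 3 else 2
    · rw [Bₙ_apply, if_neg hij.ne]
      split_ifs <;> omega
    · rw [tBmat_apply_of_lt (Fin.lt_def.2 (by simpa using hij'))]
      have := val_tBshift k i
      have := val_tBshift k j
      split_ifs <;> omega
  rcases lt_trichotomy i j with h | rfl | h
  · exact key i j h
  · rw [CoxeterMatrix.diagonal, CoxeterMatrix.diagonal]
  · rw [CoxeterMatrix.symmetric, key j i h, CoxeterMatrix.symmetric]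

/-- The length of the longest element of the parabolic subgroup `W_J` of the Coxeter group of
type `B̃ₙ`. -/
noncomputable def tBlen (n : ℕ) (J : Finset (Fin (n + 1))) : ℕ :=
  (tBmat n).toCoxeterSystem.length (w0 (tBmat n).toCoxeterSystem (J : Set (Fin (n + 1))))

/-- The summand of `chiAffB n` indexed by `J`. -/
noncomputable def tBterm (n : ℕ) (J : Finset (Fin (n + 1))) : ℤ[X] :=
  (-1) ^ J.card * X ^ tBlen n J

lemma tBshift_image_ne_univ (k : ℕ) (J : Set (Fin (n - k))) :
    tBshift n k '' J ≠ Set.univ := by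
  intro h
  obtain ⟨i, -, hi⟩ := h.ge (Set.mem_univ 0)
  have := congrArg Fin.val hi
  simp at this

lemma tBlen_map_tBshift (hn : 3 ≤ n) (k : ℕ) (J : Finset (Fin (n - k))) :
    tBlen n (J.map (tBshift n k)) = lenB (n - k) J := by
  rw [tBlen, lenB, Finset.coe_map]
  exact (isCartan_tBcartan hn).length_w0_image _ _ (tBshift n k).injective (Bₙ_eq_tBmat hn k)
    (finite_parabolic_of_ne_univ _ hn (tBshift_image_ne_univ k _))

lemma tBlen_map_swap (hn : 3 ≤ n) {J : Finset (Fin (n + 1))} (hJ : J ≠ Finset.univ) :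
    tBlen n (J.map (Equiv.swap 0 1).toEmbedding) = tBlen n J := by
  rw [tBlen, tBlen, Finset.coe_map]
  refine (isCartan_tBcartan hn).length_w0_image _ _ (Equiv.swap 0 1).injective (tBmat_swap hn)
    (finite_parabolic_swap _ hn (finite_parabolic_of_ne_univ _ hn ?_))
  rwa [Ne, Finset.coe_eq_univ]

lemma tBterm_map_swap (hn : 3 ≤ n) {J : Finset (Fin (n + 1))} (hJ : J ≠ Finset.univ) :
    tBterm n (J.map (Equiv.swap 0 1).toEmbedding) = tBterm n J := by
  rw [tBterm, tBterm, tBlen_map_swap hn hJ, Finset.card_map]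

lemma tBlen_union_map_tBshift (hn : 3 ≤ n) {k : ℕ} (hk : 2 ≤ k) (hkn : k ≤ n)
    (J : Finset (Fin (n - k))) :
    tBlen n (({l | (l : ℕ) < k} : Finset (Fin (n + 1))) ∪ J.map (tBshift n k)) =
      k * (k - 1) + lenB (n - k) J := by
  have hA := isCartan_tBcartan hn
  obtain ⟨u, hu, hul⟩ := exists_isLong_lt (tBmat n).toCoxeterSystem hn hk hkn
  obtain ⟨v, hv⟩ := exists_isLong_of_finite (tBmat n).toCoxeterSystem
    (finite_parabolic_of_ne_univ (tBmat n).toCoxeterSystem hn (tBshift_image_ne_univ k J))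
  have hlong := hu.mul _ hA hv fun i hi j hj => by
    obtain ⟨j, -, rfl⟩ := hj
    exact tBcartan_eq_zero hn hk hi (by simp; omega)
  rw [← tBlen_map_tBshift hn, tBlen, tBlen, Finset.coe_union, Finset.coe_map,
    Finset.coe_filter_univ, hlong.1.length_w0 _ hA, hlong.2, hul, hv.length_w0 _ hA]

lemma sum_eq_sum_tBshift {R : Type*} [AddCommMonoid R] (g : Finset (Fin (n + 1)) → R) {k : ℕ}
    {D : Finset (Fin (n + 1))} (hD : ∀ l ∈ D, (l : ℕ) ≤ k) :
    ∑ J with ∀ l : Fin (n + 1), (l : ℕ) ≤ k → (l ∈ J ↔ l ∈ D), g J =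
      ∑ J : Finset (Fin (n - k)), g (D ∪ J.map (tBshift n k)) := by
  symm
  have hlt : ∀ i, k < (tBshift n k i : ℕ) := fun i => by simp; omega
  refine Finset.sum_nbij' (fun J => D ∪ J.map (tBshift n k))
    (fun J => Finset.univ.filter fun i => tBshift n k i ∈ J) ?_ ?_ ?_ ?_ fun _ _ => rfl
  · intro J _
    simp only [Finset.mem_filter, Finset.mem_univ, true_and, Finset.mem_union, Finset.mem_map]
    refine fun l hl => or_iff_left ?_
    rintro ⟨i, -, rfl⟩
    exact (hlt i).not_ge hl
  · simp
  · intro J _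
    ext i
    simp only [Finset.mem_filter, Finset.mem_univ, true_and, Finset.mem_union,
      Finset.mem_map' (tBshift n k)]
    exact or_iff_right fun h => (hlt i).not_ge (hD _ h)
  · intro J hJ
    simp only [Finset.mem_filter, Finset.mem_univ, true_and] at hJ
    ext l
    simp only [Finset.mem_union, Finset.mem_map, Finset.mem_filter, Finset.mem_univ, true_and]
    constructor
    · rintro (h | ⟨i, hi, rfl⟩)
      · exact (hJ l (hD l h)).2 h
      · exact hi
    · intro h
      by_cases hl : (l : ℕ) ≤ k
      · exact Or.inl ((hJ l hl).1 h)
      · have := l.isLt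
        have e : tBshift n k ⟨l - (k + 1), by omega⟩ = l := Fin.ext (by simp; omega)
        exact Or.inr ⟨_, by rwa [e], e⟩

lemma sum_tBterm_of_not_mem (hn : 3 ≤ n) (k : ℕ) :
    ∑ J with ∀ l : Fin (n + 1), (l : ℕ) ≤ k → l ∉ J, tBterm n J = chiB (n - k) := by
  have := sum_eq_sum_tBshift (tBterm n) (k := k) (D := ∅) (by simp)
  simp only [Finset.notMem_empty, iff_false, Finset.empty_union] at this
  rw [this, chiB]
  exact Finset.sum_congr rfl fun J _ => by
    rw [tBterm, Finset.card_map, tBlen_map_tBshift hn]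

lemma sum_tBterm_of_two_le (hn : 3 ≤ n) {k : ℕ} (hk : 2 ≤ k) (hkn : k ≤ n) :
    ∑ J with ∀ l : Fin (n + 1), (l : ℕ) ≤ k → (l ∈ J ↔ (l : ℕ) < k), tBterm n J =
      (-1) ^ k * X ^ (k * (k - 1)) * chiB (n - k) := by
  have := sum_eq_sum_tBshift (tBterm n) (k := k) (D := {l | (l : ℕ) < k})
    (by simp only [Finset.mem_filter, Finset.mem_univ, true_and]; omega)
  simp only [Finset.mem_filter, Finset.mem_univ, true_and] at this
  rw [this, chiB, Finset.mul_sum]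
  refine Finset.sum_congr rfl fun J _ => ?_
  rw [tBterm, tBlen_union_map_tBshift hn hk hkn, Finset.card_union_of_disjoint, Finset.card_map,
    Fin.card_filter_val_lt, min_eq_right (by omega), pow_add, pow_add]
  · ring
  · rw [Finset.disjoint_left]
    intro l hl hl'
    obtain ⟨i, -, rfl⟩ := Finset.mem_map.1 hl'
    simp at hl
    omega

lemma sum_tBterm_zero_one (hn : 3 ≤ n) :
    ∑ J with ∀ l : Fin (n + 1), (l : ℕ) ≤ 1 → (l ∈ J ↔ (l : ℕ) < 1), tBterm n J =
      chiB n - chiB (n - 1) := by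
  have h1 : ((1 : Fin (n + 1)) : ℕ) = 1 := by
    rw [Fin.val_one', Nat.mod_eq_of_lt (by omega)]
  have hle : ∀ l : Fin (n + 1), (l : ℕ) ≤ 1 ↔ l = 0 ∨ l = 1 := by
    intro l
    rw [Fin.ext_iff, Fin.ext_iff, h1, Fin.val_zero]
    omega
  have hle' : ∀ l : Fin (n + 1), (l : ℕ) ≤ 0 ↔ l = 0 := by
    intro l
    rw [Fin.ext_iff, Fin.val_zero]
    omega
  have e₀ := sum_tBterm_of_not_mem hn 0
  have e₁ := sum_tBterm_of_not_mem hn 1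
  simp only [hle, hle', forall_eq_or_imp, forall_eq, Nat.sub_zero, h1, Fin.val_zero, Nat.lt_one_iff,
    iff_true, one_ne_zero, iff_false] at e₀ e₁ ⊢
  have split := Finset.sum_filter_add_sum_filter_not
    (Finset.univ.filter fun J : Finset (Fin (n + 1)) => (0 : Fin (n + 1)) ∉ J)
    (fun J => (1 : Fin (n + 1)) ∈ J) (tBterm n)
  rw [← e₀, ← e₁, eq_sub_iff_add_eq, ← split, Finset.filter_filter, Finset.filter_filter]
  congr 1
  refine Finset.sum_equiv (Equiv.finsetCongr (Equiv.swap 0 1)) (fun J => ?_) fun J hJ => ?_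
  · simp [Finset.mem_map_equiv, and_comm]
  · simp only [Finset.mem_filter, Finset.mem_univ, true_and] at hJ
    rw [Equiv.finsetCongr_apply, tBterm_map_swap hn]
    rintro rfl
    exact hJ.2 (Finset.mem_univ _)

lemma sum_eq_sum_range_add {R : Type*} [AddCommMonoid R] (g : Finset (Fin (n + 1)) → R) (m : ℕ)
    (hm : m ≤ n + 1) :
    ∑ J, g J = ∑ k ∈ Finset.range m,
        ∑ J with ∀ l : Fin (n + 1), (l : ℕ) ≤ k → (l ∈ J ↔ (l : ℕ) < k), g J +
      ∑ J with ∀ l : Fin (n + 1), (l : ℕ) < m → l ∈ J, g J := by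
  induction m with
  | zero => simp
  | succ m ih =>
    have split := Finset.sum_filter_add_sum_filter_not
      (Finset.univ.filter fun J : Finset (Fin (n + 1)) => ∀ l : Fin (n + 1), (l : ℕ) < m → l ∈ J)
      (fun J => (⟨m, hm⟩ : Fin (n + 1)) ∈ J) g
    rw [ih (by omega), Finset.sum_range_succ, add_assoc, ← split, Finset.filter_filter, Finset.filter_filter, add_comm (∑ J with _ ∧ _, g J)]
    congr 3 <;> ext J <;> simp only [Finset.mem_filter, Finset.mem_univ, true_and]
    · constructor
      · rintro ⟨h, h'⟩ l hl
        refine ⟨fun hJ => lt_of_le_of_ne hl ?_, h l⟩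
        rintro rfl
        exact h' hJ
      · exact fun h => ⟨fun l hl => (h l hl.le).2 hl, fun h' => ((h _ le_rfl).1 h').false⟩
    · constructor
      · rintro ⟨h, h'⟩ l hl
        rcases (Nat.lt_succ_iff_lt_or_eq).1 hl with hl | hl
        · exact h l hl
        · rwa [show l = ⟨m, hm⟩ from Fin.ext hl]
      · exact fun h => ⟨fun l hl => h l (by omega), h _ (by simp)⟩

lemma sum_erase_univ_eq {R : Type*} [AddCommGroup R] (g : Finset (Fin (n + 1)) → R) :
    ∑ J ∈ Finset.univ.erase Finset.univ, g J = ∑ k ∈ Finset.range (n + 1),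
        ∑ J with ∀ l : Fin (n + 1), (l : ℕ) ≤ k → (l ∈ J ↔ (l : ℕ) < k), g J := by
  rw [Finset.sum_erase_eq_sub (Finset.mem_univ _), sum_eq_sum_range_add g (n + 1) le_rfl,
    sub_eq_iff_eq_add]
  congr 1
  refine Finset.sum_eq_single_of_mem _ (by simp) fun J hJ hne => (hne ?_).elim
  simp only [Finset.mem_filter, Finset.mem_univ, true_and, Fin.is_lt, forall_const] at hJ
  exact Finset.eq_univ_iff_forall.2 hJ

lemma chiAffB_eq_sum (hn : 3 ≤ n) :
    chiAffB n = ∑ J ∈ Finset.univ.erase Finset.univ, tBterm n J := by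
  rw [chiAffB, ← finsum_mem_coe_finset]
  refine finsum_mem_congr (Set.ext fun J => ?_) fun _ _ => rfl
  simp only [Set.mem_ofPred_eq, Finset.coe_erase, Finset.coe_univ, Set.mem_sdiff, Set.mem_univ,
    true_and, Set.mem_singleton_iff]
  constructor
  · rintro h rfl
    rw [Finset.coe_univ] at h
    exact not_finite_parabolic_tBmat _ hn h
  · exact fun h => finite_parabolic_of_ne_univ _ hn (by rwa [Ne, Finset.coe_eq_univ])

end Sum

end AffineB

/-- for `n ≥ 3`, every proper parabolic subgroup of `B̃ₙ` is finite
(hence `χ̂_{B̃ₙ}` is a polynomial), and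
`χ̂_{B̃ₙ}(q) = χ̂_{Bₙ}(q) + Σ_{k=0}^{n} (-1)^k q^(k(k-1)) χ̂_{B_{n-k}}(q)`
(with `χ̂_{B_i} = 1` for `i ≤ 0`). -/
theorem chiAff_tB (n : ℕ) (hn : 3 ≤ n) :
    (∀ J : Finset (Fin (n + 1)), J ≠ Finset.univ →
      ((parabolic (tBmat n).toCoxeterSystem (↑J : Set (Fin (n + 1)))) :
        Set (tBmat n).Group).Finite) ∧
    chiAffB n = chiB n +
      ∑ k ∈ Finset.range (n + 1),
        (-1 : Polynomial ℤ) ^ k * X ^ (k * (k - 1)) * chiB (n - k) := by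
  refine ⟨fun J hJ => finite_parabolic_of_ne_univ _ hn (by rwa [Ne, Finset.coe_eq_univ]), ?_⟩
  have key : ∀ k ∈ Finset.range (n + 1),
      ∑ J with ∀ l : Fin (n + 1), (l : ℕ) ≤ k → (l ∈ J ↔ (l : ℕ) < k), tBterm n J =
        (if k = 1 then chiB n else 0) + (-1) ^ k * X ^ (k * (k - 1)) * chiB (n - k) := by
    intro k hk
    rcases k with _ | _ | k
    · simpa [iff_false] using sum_tBterm_of_not_mem hn 0
    · rw [sum_tBterm_zero_one hn]
      simp [sub_eq_add_neg]
    · rw [sum_tBterm_of_two_le hn (by omega) (by simp at hk; omega), if_neg (by omega), zero_add]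
  rw [chiAffB_eq_sum hn, sum_erase_univ_eq, Finset.sum_congr rfl key, Finset.sum_add_distrib,
    Finset.sum_ite_eq', if_pos (by simp; omega)]

end CoxeterCharPoly
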